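/- Let K = F(θ) be a quadratic field extension of F with θ̄ = −θ, and let A be a central simple superalgebra of odd type over K. Then A has a K/F-superinvolution if and only if both of the following hold: (i) the quadratic graded K-algebra Z(A) (the ordinary center of A, with its induced grading) has a K/F-superinvolution, and (ii) the central simple K-algebra A₀ has an involution of the second kind, i.e. a K/F-semilinear antiautomorphism of order 2. -/

import Mathlib

section KF

variable (F K : Type*) [Field F] [Field K] [Algebra F K] (conj : K ≃ₐ[F] K)
variable {B : Type*} [Ring B] [Algebra K B] (ℬ : ZMod 2 → Submodule K B)

/-- A `K/F`-superinvolution: a graded additive bijection which is `conj`-semilinear,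
reverses products with the Koszul sign, and has order two. -/
def IsKFSuperInvolution (ξ : B ≃+ B) : Prop :=
  (∀ (lam : K) (x : B), ξ (lam • x) = conj lam • ξ x) ∧
  (∀ (i : ZMod 2), ∀ x ∈ ℬ i, ξ x ∈ ℬ i) ∧
  (∀ (i j : ZMod 2), ∀ x ∈ ℬ i, ∀ y ∈ ℬ j,
    ξ (x * y) = ((-1 : K) ^ (i.val * j.val)) • (ξ y * ξ x)) ∧
  (∀ x, ξ (ξ x) = x)

end KF

section Core

variable (K : Type*) {A : Type*} [Field K] [Ring A] [Algebra K A]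
variable (𝒜 : ZMod 2 → Submodule K A)

/-- The graded center reduces to `K·1`. -/
def SuperCentral : Prop :=
  ∀ (i : ZMod 2), ∀ x ∈ 𝒜 i,
    (∀ (j : ZMod 2), ∀ h ∈ 𝒜 j, x * h = ((-1 : K) ^ (i.val * j.val)) • (h * x)) →
    ∃ c : K, x = algebraMap K A c

/-- Graded simplicity: `A ≠ 0` and no proper nonzero graded two-sided ideals. -/
def SuperSimple [GradedAlgebra 𝒜] : Prop :=
  (∃ x : A, x ≠ 0) ∧
  ∀ I : TwoSidedIdeal A,
    (∀ x ∈ I, ∀ i : ZMod 2, ((DirectSum.decompose 𝒜 x i : 𝒜 i) : A) ∈ I) →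
    I = ⊥ ∨ I = ⊤

/-- Odd type: the ordinary center meets the odd part nontrivially. -/
def OddType : Prop :=
  ∃ x : A, x ≠ 0 ∧ x ∈ 𝒜 1 ∧ ∀ y : A, x * y = y * x

/-- The even part `A₀` of a superalgebra, as a subalgebra. -/
def evenPart [GradedAlgebra 𝒜] : Subalgebra K A :=
  Submodule.toSubalgebra (𝒜 0) (SetLike.one_mem_graded 𝒜)
    (fun x y hx hy => by simpa using SetLike.mul_mem_graded hx hy)

end Core

section Helpers

open DirectSum

variable {F K A : Type*} [Field F] [Field K] [Algebra F K] [Ring A] [Algebra K A]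
  {𝒜 : ZMod 2 → Submodule K A} {conj : K ≃ₐ[F] K}

theorem ZMod.two_cases (i : ZMod 2) : i = 0 ∨ i = 1 := by
  revert i; decide

/-- An element of a superalgebra is the sum of its even and odd parts. -/
theorem decompose_zero_add_decompose_one [GradedAlgebra 𝒜] (x : A) :
    ((decompose 𝒜 x 0 : 𝒜 0) : A) + ((decompose 𝒜 x 1 : 𝒜 1) : A) = x := by
  classical
  conv_rhs => rw [← DirectSum.sum_support_decompose 𝒜 x]
  rw [Finset.sum_subset (Finset.subset_univ _)]
  · exact (Fin.sum_univ_two fun i : ZMod 2 => ((decompose 𝒜 x i : 𝒜 i) : A)).symm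
  · intro i _ hi
    simpa using hi

/-- Left multiplication by a nonzero odd central element is injective in a graded simple
superalgebra. -/
theorem SuperSimple.eq_zero_of_odd_central_mul_eq_zero [GradedAlgebra 𝒜]
    (hsimple : SuperSimple K 𝒜)
    {z : A} (hz : z ≠ 0) (hz1 : z ∈ 𝒜 1) (hzc : ∀ y, z * y = y * z) {x : A}
    (hx : z * x = 0) : x = 0 := by
  let I : TwoSidedIdeal A := TwoSidedIdeal.mk' {x | z * x = 0} (by simp)
    (fun {a b} ha hb => by
      simp only [Set.mem_ofPred_eq] at *
      rw [mul_add, ha, hb, add_zero])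
    (fun {a} ha => by
      simp only [Set.mem_ofPred_eq] at *
      rw [mul_neg, ha, neg_zero])
    (fun {a b} hb => by
      simp only [Set.mem_ofPred_eq] at *
      rw [← mul_assoc, hzc, mul_assoc, hb, mul_zero])
    (fun {a b} ha => by
      simp only [Set.mem_ofPred_eq] at *
      rw [← mul_assoc, ha, zero_mul])
  have hI : ∀ y, y ∈ I ↔ z * y = 0 := fun y => by
    simp [I, TwoSidedIdeal.mem_mk']
  rcases hsimple.2 I (fun y hy i => by
    rw [hI] at hy ⊢
    rw [← coe_decompose_mul_add_of_left_mem 𝒜 hz1, hy]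
    simp) with h | h
  · have : x ∈ I := (hI x).2 hx
    rwa [h, TwoSidedIdeal.mem_bot] at this
  · have : (1 : A) ∈ I := h ▸ trivial
    rw [hI, mul_one] at this
    exact absurd this hz

/-- Even central elements are scalars. -/
theorem SuperCentral.exists_of_even (hcentral : SuperCentral K 𝒜) {x : A}
    (hx0 : x ∈ 𝒜 0) (hx : ∀ y, x * y = y * x) : ∃ c : K, x = algebraMap K A c :=
  hcentral 0 x hx0 fun j h _ => by simpa using hx h

/-- The square of a nonzero odd central element is a nonzero scalar. -/
theorem exists_ne_zero_mul_self_eq_algebraMap [GradedAlgebra 𝒜]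
    (hcentral : SuperCentral K 𝒜) (hsimple : SuperSimple K 𝒜)
    {z : A} (hz : z ≠ 0) (hz1 : z ∈ 𝒜 1) (hzc : ∀ y, z * y = y * z) :
    ∃ c : K, c ≠ 0 ∧ z * z = algebraMap K A c := by
  obtain ⟨c, hc⟩ := hcentral.exists_of_even (x := z * z) (SetLike.mul_mem_graded hz1 hz1)
    (fun y => by rw [mul_assoc, hzc y, ← mul_assoc, hzc y, mul_assoc])
  refine ⟨c, ?_, hc⟩
  rintro rfl
  exact hz (hsimple.eq_zero_of_odd_central_mul_eq_zero hz hz1 hzc (by simpa using hc))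

/-- The homogeneous components of a central element are central. -/
theorem decompose_mul_comm_of_central [GradedAlgebra 𝒜] {x : A} (hx : ∀ y, x * y = y * x)
    (i : ZMod 2) (y : A) :
    ((decompose 𝒜 x i : 𝒜 i) : A) * y = y * ((decompose 𝒜 x i : 𝒜 i) : A) := by
  have key : ∀ j, ∀ h ∈ 𝒜 j,
      ((decompose 𝒜 x i : 𝒜 i) : A) * h = h * ((decompose 𝒜 x i : 𝒜 i) : A) := by
    intro j h hh
    rw [← coe_decompose_mul_add_of_right_mem 𝒜 hh, ← coe_decompose_mul_add_of_left_mem 𝒜 hh,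
      hx, add_comm]
  rw [← decompose_zero_add_decompose_one (𝒜 := 𝒜) y, mul_add, add_mul,
    key 0 _ (SetLike.coe_mem _), key 1 _ (SetLike.coe_mem _)]

namespace IsKFSuperInvolution

/-- A superinvolution maps homogeneous central elements to central elements. -/
theorem mul_comm_of_homogeneous [GradedAlgebra 𝒜] {ξ : A ≃+ A}
    (h : IsKFSuperInvolution F K conj 𝒜 ξ) {i : ZMod 2} {x : A} (hi : x ∈ 𝒜 i)
    (hx : ∀ y, x * y = y * x) (y : A) : ξ x * y = y * ξ x := by
  have key : ∀ j, ∀ y ∈ 𝒜 j, ξ x * y = y * ξ x := by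
    intro j y hy
    have h1 := h.2.2.1 i j x hi (ξ y) (h.2.1 j y hy)
    have h2 := h.2.2.1 j i (ξ y) (h.2.1 j y hy) x hi
    rw [← hx, h1, h.2.2.2, mul_comm j.val] at h2
    exact (smul_right_injective A (pow_ne_zero _ (neg_ne_zero.2 one_ne_zero)) h2).symm
  rw [← decompose_zero_add_decompose_one (𝒜 := 𝒜) y, mul_add, add_mul,
    key 0 _ (SetLike.coe_mem _), key 1 _ (SetLike.coe_mem _)]

theorem map_mem_center [GradedAlgebra 𝒜] {ξ : A ≃+ A}
    (h : IsKFSuperInvolution F K conj 𝒜 ξ) {x : A} (hx : x ∈ Subalgebra.center K A) :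
    ξ x ∈ Subalgebra.center K A := by
  rw [Subalgebra.mem_center_iff] at hx ⊢
  intro y
  rw [← decompose_zero_add_decompose_one (𝒜 := 𝒜) x, map_add, mul_add, add_mul,
    h.mul_comm_of_homogeneous (SetLike.coe_mem _)
      (decompose_mul_comm_of_central (fun y => (hx y).symm) _),
    h.mul_comm_of_homogeneous (SetLike.coe_mem _)
      (decompose_mul_comm_of_central (fun y => (hx y).symm) _)]

/-- A superinvolution of `A` restricts to a superinvolution of the center. -/
theorem exists_center [GradedAlgebra 𝒜] {ξ : A ≃+ A}
    (h : IsKFSuperInvolution F K conj 𝒜 ξ) :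
    ∃ ζ : Subalgebra.center K A ≃+ Subalgebra.center K A,
      IsKFSuperInvolution F K conj
        (fun i => (𝒜 i).comap (Subalgebra.center K A).val.toLinearMap) ζ := by
  refine ⟨{ toFun := fun x => ⟨ξ x, h.map_mem_center x.2⟩
            invFun := fun x => ⟨ξ x, h.map_mem_center x.2⟩
            left_inv := fun x => Subtype.ext (h.2.2.2 _)
            right_inv := fun x => Subtype.ext (h.2.2.2 _)
            map_add' := fun x y => Subtype.ext (map_add ξ _ _) }, ?_, ?_, ?_, ?_⟩
  · exact fun lam x => Subtype.ext (h.1 lam x)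
  · exact fun i x hx => h.2.1 i x hx
  · exact fun i j x hx y hy => Subtype.ext (h.2.2.1 i j x hx y hy)
  · exact fun x => Subtype.ext (h.2.2.2 _)

/-- A superinvolution of `A` restricts to an involution of the second kind of `A₀`. -/
theorem exists_evenPart [GradedAlgebra 𝒜] {ξ : A ≃+ A}
    (h : IsKFSuperInvolution F K conj 𝒜 ξ) :
    ∃ ψ : evenPart K 𝒜 ≃+ evenPart K 𝒜,
      (∀ (lam : K) (x : evenPart K 𝒜), ψ (lam • x) = conj lam • ψ x) ∧
      (∀ x y : evenPart K 𝒜, ψ (x * y) = ψ y * ψ x) ∧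
      (∀ x, ψ (ψ x) = x) := by
  refine ⟨{ toFun := fun x => ⟨ξ x, h.2.1 0 x x.2⟩
            invFun := fun x => ⟨ξ x, h.2.1 0 x x.2⟩
            left_inv := fun x => Subtype.ext (h.2.2.2 _)
            right_inv := fun x => Subtype.ext (h.2.2.2 _)
            map_add' := fun x y => Subtype.ext (map_add ξ _ _) }, ?_, ?_, ?_⟩
  · exact fun lam x => Subtype.ext (h.1 lam x)
  · exact fun x y => Subtype.ext (by simpa using h.2.2.1 0 0 x x.2 y y.2)
  · exact fun x => Subtype.ext (h.2.2.2 _)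

end IsKFSuperInvolution

/-- Gluing: if `z` is an odd central element with `z² = c ≠ 0`, an involution of the second kind
`Ψ` of the even part together with an image `k z` of `z` subject to the two evident compatibility
conditions defines a superinvolution of `A`. -/
theorem exists_isKFSuperInvolution_of_evenPart [GradedAlgebra 𝒜]
    {z : A} (hz1 : z ∈ 𝒜 1) (hzc : ∀ y, z * y = y * z)
    {c : K} (hc : c ≠ 0) (hzz : z * z = algebraMap K A c)
    {k : K} (hk : conj k * k = 1) (hkc : k * k * c = -conj c)
    (ψ : evenPart K 𝒜 ≃+ evenPart K 𝒜)
    (hlin : ∀ (lam : K) (x : evenPart K 𝒜), ψ (lam • x) = conj lam • ψ x)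
    (hmul : ∀ x y : evenPart K 𝒜, ψ (x * y) = ψ y * ψ x)
    (hinv : ∀ x, ψ (ψ x) = x) :
    ∃ ξ : A ≃+ A, IsKFSuperInvolution F K conj 𝒜 ξ := by
  let P : A →+ evenPart K 𝒜 :=
    { toFun := fun x => ⟨(decompose 𝒜 x 0 : 𝒜 0), SetLike.coe_mem _⟩
      map_zero' := Subtype.ext (by simp)
      map_add' := fun x y => Subtype.ext (by simp) }
  let w : A := c⁻¹ • z
  have hw1 : w ∈ 𝒜 1 := Submodule.smul_mem _ _ hz1
  have hwz : ∀ x, w * (z * x) = x := fun x => by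
    rw [← mul_assoc, smul_mul_assoc, hzz, Algebra.algebraMap_eq_smul_one, smul_smul,
      inv_mul_cancel₀ hc, one_smul, one_mul]
  have hzw : ∀ x, z * (w * x) = x := fun x => by
    rw [← mul_assoc, mul_smul_comm, hzz, Algebra.algebraMap_eq_smul_one, smul_smul,
      inv_mul_cancel₀ hc, one_smul, one_mul]
  have hP0 : ∀ a : evenPart K 𝒜, P a = a := fun a =>
    Subtype.ext (decompose_of_mem_same 𝒜 a.2)
  have hP1 : ∀ x ∈ 𝒜 1, P x = 0 := fun x hx =>
    Subtype.ext (decompose_of_mem_ne 𝒜 hx (by decide))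
  have hwodd : ∀ x ∈ 𝒜 1, w * x ∈ evenPart K 𝒜 := fun x hx =>
    SetLike.mul_mem_graded hw1 hx
  let f : A →+ A :=
    { toFun := fun x => (ψ (P x) : A) + (k • z) * (ψ (P (w * x)) : A)
      map_zero' := by simp
      map_add' := fun x y => by
        simp only [map_add, mul_add, Subalgebra.coe_add]
        abel }
  have hf0 : ∀ a : evenPart K 𝒜, f a = ψ a := fun a => by
    have : P (w * a) = 0 := hP1 _ (by simpa using SetLike.mul_mem_graded hw1 a.2)
    simp [f, hP0, this]
  have hf1 : ∀ a : evenPart K 𝒜, f (z * a) = k • (z * (ψ a : A)) := fun a => by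
    have : P (z * a) = 0 := hP1 _ (by simpa using SetLike.mul_mem_graded hz1 a.2)
    simp [f, hwz, hP0, this]
  have hodd : ∀ x ∈ 𝒜 1, ∃ a : evenPart K 𝒜, x = z * a := fun x hx =>
    ⟨⟨w * x, hwodd x hx⟩, (hzw x).symm⟩
  have hsum : ∀ x, ∃ a b : evenPart K 𝒜, x = a + z * b := fun x => by
    obtain ⟨b, hb⟩ := hodd (decompose 𝒜 x 1 : 𝒜 1) (SetLike.coe_mem _)
    exact ⟨P x, b, by rw [← hb]; exact (decompose_zero_add_decompose_one x).symm⟩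
  have hsmul : ∀ (lam : K) (x : A), f (lam • x) = conj lam • f x := by
    intro lam x
    obtain ⟨a, b, rfl⟩ := hsum x
    rw [smul_add, ← mul_smul_comm, ← Subalgebra.coe_smul, ← Subalgebra.coe_smul, map_add,
      map_add, hf0, hf0, hf1, hf1, hlin, hlin, smul_add]
    simp [smul_smul, mul_comm]
  have hff : ∀ x, f (f x) = x := by
    intro x
    obtain ⟨a, b, rfl⟩ := hsum x
    rw [map_add, map_add, hf0, hf0, hf1, hsmul, hf1, hinv, hinv, smul_smul, hk, one_smul]
  refine ⟨{ f with invFun := f, left_inv := hff, right_inv := hff }, hsmul, ?_, ?_, hff⟩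
  · intro i x hx
    change f x ∈ 𝒜 i
    rcases ZMod.two_cases i with rfl | rfl
    · exact (hf0 ⟨x, hx⟩).symm ▸ (ψ ⟨x, hx⟩).2
    · obtain ⟨a, rfl⟩ := hodd x hx
      rw [hf1]
      exact Submodule.smul_mem _ _ (by simpa using SetLike.mul_mem_graded hz1 (ψ a).2)
  · intro i j x hx y hy
    change f (x * y) = _ • (f y * f x)
    rcases ZMod.two_cases i with rfl | rfl <;> rcases ZMod.two_cases j with rfl | rfl
    · lift x to evenPart K 𝒜 using hx
      lift y to evenPart K 𝒜 using hy
      rw [← Subalgebra.coe_mul, hf0, hf0, hf0, hmul]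
      simp
    · lift x to evenPart K 𝒜 using hx
      obtain ⟨b, rfl⟩ := hodd y hy
      rw [← mul_assoc, ← hzc, mul_assoc, ← Subalgebra.coe_mul, hf1, hf1, hf0, hmul]
      simp [mul_assoc]
    · lift y to evenPart K 𝒜 using hy
      obtain ⟨a, rfl⟩ := hodd x hx
      rw [mul_assoc, ← Subalgebra.coe_mul, hf1, hf1, hf0, hmul]
      simp [← mul_assoc, hzc]
    · obtain ⟨a, rfl⟩ := hodd x hx
      obtain ⟨b, rfl⟩ := hodd y hy
      have hcomm : ∀ u v : A, z * u * (z * v) = c • (u * v) := fun u v => by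
        rw [mul_assoc, ← mul_assoc u, ← hzc u, mul_assoc z u, ← mul_assoc z z, hzz,
          ← Algebra.smul_def]
      rw [hcomm, ← Subalgebra.coe_mul, hsmul, hf0, hf1, hf1, hmul, smul_mul_smul_comm, hcomm,
        smul_smul, smul_smul, mul_assoc, hkc]
      simp [ZMod.val_one]

/-- Superinvolutions of the center and involutions of the second kind of the even part glue to
superinvolutions of a superalgebra of odd type. -/
theorem exists_isKFSuperInvolution_of_center [GradedAlgebra 𝒜]
    (hcentral : SuperCentral K 𝒜) (hsimple : SuperSimple K 𝒜) (hodd : OddType K 𝒜)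
    {ζ : Subalgebra.center K A ≃+ Subalgebra.center K A}
    (hζ : IsKFSuperInvolution F K conj
      (fun i => (𝒜 i).comap (Subalgebra.center K A).val.toLinearMap) ζ)
    (ψ : evenPart K 𝒜 ≃+ evenPart K 𝒜)
    (hlin : ∀ (lam : K) (x : evenPart K 𝒜), ψ (lam • x) = conj lam • ψ x)
    (hmul : ∀ x y : evenPart K 𝒜, ψ (x * y) = ψ y * ψ x)
    (hinv : ∀ x, ψ (ψ x) = x) :
    ∃ ξ : A ≃+ A, IsKFSuperInvolution F K conj 𝒜 ξ := by
  obtain ⟨z, hz, hz1, hzc⟩ := hodd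
  obtain ⟨c, hc, hzz⟩ := exists_ne_zero_mul_self_eq_algebraMap hcentral hsimple hz hz1 hzc
  obtain ⟨hζlin, hζgr, hζmul, hζinv⟩ := hζ
  let Z : Subalgebra.center K A := ⟨z, Subalgebra.mem_center_iff.2 fun y => (hzc y).symm⟩
  have hζZ1 : (ζ Z : A) ∈ 𝒜 1 := hζgr 1 Z hz1
  have hζZc : ∀ y, (ζ Z : A) * y = y * (ζ Z : A) := fun y =>
    (Subalgebra.mem_center_iff.1 (ζ Z).2 y).symm
  obtain ⟨d, hd⟩ := hcentral.exists_of_even (x := z * (ζ Z : A))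
    (SetLike.mul_mem_graded hz1 hζZ1)
    (fun y => by rw [mul_assoc, hζZc y, ← mul_assoc, hzc y, mul_assoc])
  have hk : ζ Z = (c⁻¹ * d) • Z := by
    apply Subtype.ext
    have h1 : c • (ζ Z : A) = d • z := by
      rw [Algebra.smul_def, ← hzz, mul_assoc, hd, Algebra.smul_def, ← Algebra.commutes]
    change (ζ Z : A) = (c⁻¹ * d) • z
    rw [mul_smul, ← h1, smul_smul, inv_mul_cancel₀ hc, one_smul]
  generalize c⁻¹ * d = k at hk
  have hone : ζ 1 = 1 := by
    have h1 : (1 : Subalgebra.center K A) ∈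
        (𝒜 0).comap (Subalgebra.center K A).val.toLinearMap := SetLike.one_mem_graded 𝒜
    have h2 := hζmul 0 0 (ζ 1) (hζgr 0 1 h1) 1 h1
    rw [mul_one, hζinv] at h2
    simpa using h2.symm
  have hZZ : Z * Z = c • (1 : Subalgebra.center K A) :=
    Subtype.ext (hzz.trans (Algebra.algebraMap_eq_smul_one c))
  have hscalar : ∀ a b : K, a • z = b • z → a = b := fun a b h =>
    smul_left_injective K hz h
  have : Nontrivial A := ⟨z, 0, hz⟩
  refine exists_isKFSuperInvolution_of_evenPart hz1 hzc hc hzz (k := k) ?_ ?_ ψ hlin hmul hinv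
  · refine hscalar _ _ ?_
    have := hζinv Z
    rw [hk, hζlin, hk, smul_smul] at this
    simpa using congrArg Subtype.val this
  · have := hζmul 1 1 Z hz1 Z hz1
    rw [hZZ, hζlin, hone, hk, smul_mul_smul_comm, hZZ] at this
    have h2 := congrArg Subtype.val this
    have h3 : algebraMap K A (conj c) = algebraMap K A (-(k * k * c)) := by
      simpa [Algebra.algebraMap_eq_smul_one, smul_smul, ZMod.val_one] using h2
    rw [(algebraMap K A).injective h3, neg_neg]

end Helpers

/-- A central simple superalgebra of odd type over `K` has a `K/F`-superinvolution if and
only if its center `Z(A)` (a quadratic graded `K`-algebra) has a `K/F`-superinvolution and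
the central simple `K`-algebra `A₀` has an involution of the second kind. -/
theorem odd_type_KF_superinvolution_iff
    (F K : Type*) [Field F] [Field K] [Algebra F K]
    (hchar : (2 : F) ≠ 0)
    (θ : K)
    (hθsq : ∃ c : F, c ≠ 0 ∧ θ ^ 2 = algebraMap F K c ∧ ∀ d : F, d ^ 2 ≠ c)
    (hspan : ∀ x : K, ∃ c d : F, x = algebraMap F K c + algebraMap F K d * θ)
    (conj : K ≃ₐ[F] K) (hconj : conj θ = -θ)
    {A : Type*} [Ring A] [Algebra K A]
    (𝒜 : ZMod 2 → Submodule K A) [GradedAlgebra 𝒜]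
    (hfin : FiniteDimensional K A)
    (hcentral : SuperCentral K 𝒜)
    (hsimple : SuperSimple K 𝒜)
    (hodd : OddType K 𝒜) :
    (∃ ξ : A ≃+ A, IsKFSuperInvolution F K conj 𝒜 ξ) ↔
      ((∃ ζ : Subalgebra.center K A ≃+ Subalgebra.center K A,
          IsKFSuperInvolution F K conj
            (fun i => (𝒜 i).comap (Subalgebra.center K A).val.toLinearMap) ζ) ∧
       (∃ ψ : evenPart K 𝒜 ≃+ evenPart K 𝒜,
          (∀ (lam : K) (x : evenPart K 𝒜), ψ (lam • x) = conj lam • ψ x) ∧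
          (∀ x y : evenPart K 𝒜, ψ (x * y) = ψ y * ψ x) ∧
          (∀ x, ψ (ψ x) = x))) := by
  constructor
  · rintro ⟨ξ, hξ⟩
    exact ⟨hξ.exists_center, hξ.exists_evenPart⟩
  · rintro ⟨⟨ζ, hζ⟩, ψ, hlin, hmul, hinv⟩
    exact exists_isKFSuperInvolution_of_center hcentral hsimple hodd hζ ψ hlin hmul hinv
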